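/- Let w : [0,∞) → ℝ be bounded, continuous and strictly positive, and let K ⊆ C_∞([0,∞)) be a Korovkin set of C_∞([0,∞)): for every sequence (Mₙ) of positive bounded linear operators on C_∞([0,∞)) with sup_n ‖Mₙ‖ < ∞ and ‖Mₙg − g‖_∞ → 0 for all g ∈ K, one has ‖Mₙf − f‖_∞ → 0 for all f ∈ C_∞([0,∞)). Then K (viewed inside C_∞^w([0,∞))) is a Korovkin set of C_∞^w([0,∞)): for every sequence (Lₙ) of positive bounded linear operators on C_∞^w([0,∞)) with sup_n ‖Lₙ‖ < ∞ and ‖Lₙg − g‖_{∞,w} → 0 for all g ∈ K, one has ‖Lₙf − f‖_{∞,w} → 0 for all f ∈ C_∞^w([0,∞)). -/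

import Mathlib

open Filter

/-- Membership in `C_∞([0,∞))`: continuous on `[0,∞)` and vanishing at infinity. -/
def CInfty (f : ℝ → ℝ) : Prop :=
  ContinuousOn f (Set.Ici 0) ∧ Tendsto f atTop (nhds 0)

/-- The sup-norm `‖f‖_∞ = sup_{x ≥ 0} |f(x)|`. -/
noncomputable def supnorm (f : ℝ → ℝ) : ℝ := ⨆ x : Set.Ici (0 : ℝ), |f (x : ℝ)|

/-- Membership in the weighted space `C_∞^w([0,∞))`: continuous on `[0,∞)` and `w·f` vanishes
at infinity. -/
def CInftyW (w : ℝ → ℝ) (f : ℝ → ℝ) : Prop :=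
  ContinuousOn f (Set.Ici 0) ∧ Tendsto (fun x => w x * f x) atTop (nhds 0)

/-- The weighted sup-norm `‖f‖_{∞,w} = sup_{x ≥ 0} |w(x) f(x)|`. -/
noncomputable def wsupnorm (w : ℝ → ℝ) (f : ℝ → ℝ) : ℝ :=
  ⨆ x : Set.Ici (0 : ℝ), |w (x : ℝ) * f (x : ℝ)|

/-- `K` is a Korovkin set of `C_∞([0,∞))`: for every uniformly bounded sequence of positive
linear operators `(Mₙ)` on `C_∞([0,∞))` with `‖Mₙ g − g‖_∞ → 0` for all `g ∈ K`, one has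
`‖Mₙ f − f‖_∞ → 0` for all `f ∈ C_∞([0,∞))`. -/
def IsKorovkinSet (K : Set (ℝ → ℝ)) : Prop :=
  ∀ M : ℕ → (ℝ → ℝ) → (ℝ → ℝ),
    (∀ n f, CInfty f → CInfty (M n f)) →
    (∀ n f g, CInfty f → CInfty g → ∀ x ≥ (0 : ℝ),
      M n (f + g) x = M n f x + M n g x) →
    (∀ n (c : ℝ) f, CInfty f → ∀ x ≥ (0 : ℝ), M n (c • f) x = c * M n f x) →
    (∀ n f, CInfty f → (∀ x ≥ (0 : ℝ), 0 ≤ f x) → ∀ x ≥ (0 : ℝ), 0 ≤ M n f x) →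
    (∃ C : ℝ, ∀ n f, CInfty f → ∀ x ≥ (0 : ℝ), |M n f x| ≤ C * supnorm f) →
    (∀ g ∈ K, ∀ ε > (0 : ℝ), ∃ N : ℕ, ∀ n ≥ N, ∀ x ≥ (0 : ℝ), |M n g x - g x| < ε) →
    ∀ f, CInfty f → ∀ ε > (0 : ℝ), ∃ N : ℕ, ∀ n ≥ N, ∀ x ≥ (0 : ℝ), |M n f x - f x| < ε

/-- `K` is a Korovkin set of `C_∞^w([0,∞))`: the same property with respect to the weighted
norm `‖·‖_{∞,w}`. -/
def IsKorovkinSetW (w : ℝ → ℝ) (K : Set (ℝ → ℝ)) : Prop :=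
  ∀ L : ℕ → (ℝ → ℝ) → (ℝ → ℝ),
    (∀ n f, CInftyW w f → CInftyW w (L n f)) →
    (∀ n f g, CInftyW w f → CInftyW w g → ∀ x ≥ (0 : ℝ),
      L n (f + g) x = L n f x + L n g x) →
    (∀ n (c : ℝ) f, CInftyW w f → ∀ x ≥ (0 : ℝ), L n (c • f) x = c * L n f x) →
    (∀ n f, CInftyW w f → (∀ x ≥ (0 : ℝ), 0 ≤ f x) → ∀ x ≥ (0 : ℝ), 0 ≤ L n f x) →
    (∃ C : ℝ, ∀ n f, CInftyW w f → ∀ x ≥ (0 : ℝ), |w x * L n f x| ≤ C * wsupnorm w f) →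
    (∀ g ∈ K, ∀ ε > (0 : ℝ), ∃ N : ℕ, ∀ n ≥ N, ∀ x ≥ (0 : ℝ),
      w x * |L n g x - g x| < ε) →
    ∀ f, CInftyW w f → ∀ ε > (0 : ℝ), ∃ N : ℕ, ∀ n ≥ N, ∀ x ≥ (0 : ℝ),
      w x * |L n f x - f x| < ε

theorem CInfty.exists_abs_le {f : ℝ → ℝ} (hf : CInfty f) :
    ∃ B : ℝ, ∀ x ≥ (0 : ℝ), |f x| ≤ B := by
  obtain ⟨R, hR⟩ := eventually_atTop.1 (hf.2.eventually (Metric.ball_mem_nhds 0 one_pos))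
  obtain ⟨B, hB⟩ := (isCompact_Icc (a := (0 : ℝ)) (b := R)).exists_bound_of_continuousOn
    (hf.1.mono Set.Icc_subset_Ici_self)
  refine ⟨max B 1, fun x hx => ?_⟩
  rcases le_total x R with h | h
  · exact (hB x ⟨hx, h⟩).trans (le_max_left _ _)
  · have := hR x h
    rw [Real.dist_eq, sub_zero] at this
    exact this.le.trans (le_max_right _ _)

theorem CInfty.abs_le_supnorm {f : ℝ → ℝ} (hf : CInfty f) {x : ℝ} (hx : 0 ≤ x) :
    |f x| ≤ supnorm f := by
  obtain ⟨B, hB⟩ := hf.exists_abs_le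
  refine le_ciSup (f := fun x : Set.Ici (0 : ℝ) => |f (x : ℝ)|) ⟨B, ?_⟩ ⟨x, hx⟩
  rintro _ ⟨y, rfl⟩
  exact hB y y.2

theorem wsupnorm_le {w f : ℝ → ℝ} {B : ℝ} (h : ∀ x ≥ (0 : ℝ), |w x * f x| ≤ B) :
    wsupnorm w f ≤ B :=
  ciSup_le fun x : Set.Ici (0 : ℝ) => h x x.2

theorem CInfty.add {f g : ℝ → ℝ} (hf : CInfty f) (hg : CInfty g) : CInfty (f + g) :=
  ⟨hf.1.add hg.1, (zero_add (0 : ℝ)) ▸ hf.2.add hg.2⟩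

theorem CInftyW.sub {w f g : ℝ → ℝ} (hf : CInftyW w f) (hg : CInftyW w g) :
    CInftyW w (f - g) :=
  ⟨hf.1.sub hg.1, by simpa [mul_sub] using hf.2.sub hg.2⟩

theorem CInfty.cinftyW {w f : ℝ → ℝ} (hw : ∃ C : ℝ, ∀ x ≥ (0 : ℝ), w x ≤ C)
    (hwpos : ∀ x ≥ (0 : ℝ), 0 < w x) (hf : CInfty f) : CInftyW w f := by
  obtain ⟨C, hC⟩ := hw
  refine ⟨hf.1, squeeze_zero_norm' (a := fun x => C * |f x|) ?_ ?_⟩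
  · filter_upwards [eventually_ge_atTop 0] with x hx
    rw [Real.norm_eq_abs, abs_mul, abs_of_pos (hwpos x hx)]
    exact mul_le_mul_of_nonneg_right (hC x hx) (abs_nonneg _)
  · simpa using hf.2.abs.const_mul C

/-- `C_∞([0,∞))` is dense in `C_∞^w([0,∞))`. -/
theorem CInftyW.exists_cinfty_approx {w f : ℝ → ℝ} (hf : CInftyW w f) {ε : ℝ} (hε : 0 < ε) :
    ∃ h, CInfty h ∧ ∀ x ≥ (0 : ℝ), |w x * (f - h) x| ≤ ε := by
  obtain ⟨R, hR⟩ := eventually_atTop.1 (hf.2.eventually (Metric.ball_mem_nhds 0 hε))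
  set χ : ℝ → ℝ := fun x => max 0 (min 1 (R + 1 - x)) with hχ
  have χ0 (x) : 0 ≤ χ x := le_max_left _ _
  have χ1 (x) : χ x ≤ 1 := max_le zero_le_one (min_le_left _ _)
  have χc : Continuous χ := by fun_prop
  refine ⟨fun x => f x * χ x, ⟨hf.1.mul χc.continuousOn, ?_⟩, fun x hx => ?_⟩
  · refine tendsto_const_nhds.congr' ?_
    filter_upwards [eventually_ge_atTop (R + 1)] with x hx
    have : χ x = 0 := max_eq_left ((min_le_right _ _).trans (by linarith))
    simp [this]
  · rcases le_total x R with h | h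
    · have : χ x = 1 := by
        simp only [hχ]
        rw [min_eq_left (by linarith), max_eq_right zero_le_one]
      simp [this, hε.le]
    · have h1 := hR x h
      rw [Real.dist_eq, sub_zero] at h1
      have h2 : w x * (f - fun x => f x * χ x) x = w x * f x * (1 - χ x) := by
        simp only [Pi.sub_apply]; ring
      rw [h2, abs_mul, abs_of_nonneg (sub_nonneg.2 (χ1 x))]
      nlinarith [χ0 x, χ1 x, abs_nonneg (w x * f x)]

/-- A bounded positive functional that agrees with a point evaluation on a Korovkin set is that
point evaluation. -/
theorem IsKorovkinSet.functional_eq_eval {K : Set (ℝ → ℝ)} (hK : IsKorovkinSet K)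
    (hKsub : ∀ g ∈ K, CInfty g) {μ : (ℝ → ℝ) → ℝ}
    (hadd : ∀ f g, CInfty f → CInfty g → μ (f + g) = μ f + μ g)
    (hsmul : ∀ (c : ℝ) f, CInfty f → μ (c • f) = c * μ f)
    (hpos : ∀ f, CInfty f → (∀ x ≥ (0 : ℝ), 0 ≤ f x) → 0 ≤ μ f)
    (hbdd : ∃ C : ℝ, ∀ f, CInfty f → |μ f| ≤ C * supnorm f)
    {a : ℝ} (ha : 0 ≤ a) (hμ : ∀ g ∈ K, μ g = g a) {f : ℝ → ℝ} (hf : CInfty f) :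
    μ f = f a := by
  obtain ⟨C, hC⟩ := hbdd
  set φ : ℕ → ℝ → ℝ := fun n x => max 0 (1 - (n + 1) * |x - a|) with hφ
  have φ0 (n x) : 0 ≤ φ n x := le_max_left _ _
  have φ1 (n x) : φ n x ≤ 1 := max_le zero_le_one (by
    have : 0 ≤ ((n : ℝ) + 1) * |x - a| := by positivity
    linarith)
  have φc (n) : Continuous (φ n) := by fun_prop
  have φa (n) : φ n a = 1 := by simp [hφ]
  have φt (n) : Tendsto (φ n) atTop (nhds 0) := by
    refine tendsto_const_nhds.congr' ?_
    filter_upwards [eventually_ge_atTop (a + 1)] with x hx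
    refine (max_eq_left ?_).symm
    have h1 : 1 ≤ |x - a| := le_trans (by linarith) (le_abs_self _)
    nlinarith [(Nat.cast_nonneg n : (0 : ℝ) ≤ n)]
  have key := hK (fun n f x => φ n x * μ f + (1 - φ n x) * f x) ?_ ?_ ?_ ?_ ?_ ?_ f hf
  · by_contra hne
    obtain ⟨N, hN⟩ := key |μ f - f a| (abs_pos.2 (sub_ne_zero.2 hne))
    have := hN N le_rfl a ha
    simp [φa] at this
  · intro n f hf
    refine ⟨((φc n).continuousOn.mul continuousOn_const).add
      ((continuousOn_const.sub (φc n).continuousOn).mul hf.1), ?_⟩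
    simpa using ((φt n).mul_const (μ f)).add (((φt n).const_sub 1).mul hf.2)
  · intro n f g hf hg x hx
    simp only [hadd f g hf hg, Pi.add_apply]; ring
  · intro n c f hf x hx
    simp only [hsmul c f hf, Pi.smul_apply, smul_eq_mul]; ring
  · intro n f hf h x hx
    exact add_nonneg (mul_nonneg (φ0 n x) (hpos f hf h))
      (mul_nonneg (sub_nonneg.2 (φ1 n x)) (h x hx))
  · refine ⟨|C| + 1, fun n f hf x hx => ?_⟩
    have h1 := hf.abs_le_supnorm hx
    have hs : 0 ≤ supnorm f := (abs_nonneg _).trans h1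
    have h2 : |μ f| ≤ |C| * supnorm f :=
      (hC f hf).trans (mul_le_mul_of_nonneg_right (le_abs_self C) hs)
    calc |φ n x * μ f + (1 - φ n x) * f x|
        ≤ φ n x * |μ f| + (1 - φ n x) * |f x| := by
          refine (abs_add_le _ _).trans_eq ?_
          rw [abs_mul, abs_mul, abs_of_nonneg (φ0 n x), abs_of_nonneg (sub_nonneg.2 (φ1 n x))]
      _ ≤ 1 * |μ f| + 1 * |f x| := by
          gcongr
          · exact φ1 n x
          · linarith [φ0 n x]
      _ ≤ (|C| + 1) * supnorm f := by linarith
  · intro g hg ε hε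
    obtain ⟨δ, hδ, hδg⟩ := Metric.continuousWithinAt_iff.1 ((hKsub g hg).1 a ha) ε hε
    obtain ⟨N, hN⟩ := exists_nat_one_div_lt hδ
    refine ⟨N, fun n hn x hx => ?_⟩
    have he : φ n x * μ g + (1 - φ n x) * g x - g x = φ n x * (g a - g x) := by
      rw [hμ g hg]; ring
    simp only [he, abs_mul, abs_of_nonneg (φ0 n x)]
    by_cases hxa : |x - a| < δ
    · have h1 := hδg hx (by rwa [Real.dist_eq])
      rw [Real.dist_eq, abs_sub_comm] at h1
      nlinarith [φ1 n x, φ0 n x, abs_nonneg (g a - g x)]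
    · have : φ n x = 0 := by
        refine max_eq_left ?_
        have hNn : (N : ℝ) ≤ n := by exact_mod_cast hn
        rw [div_lt_iff₀ (by positivity)] at hN
        push Not at hxa
        nlinarith [(Nat.cast_nonneg n : (0 : ℝ) ≤ n)]
      simpa [this] using hε

/-- The version of `IsKorovkinSet.functional_eq_eval` for nonnegative multiples of a point
evaluation, including zero. -/
theorem IsKorovkinSet.functional_eq_mul_eval {K : Set (ℝ → ℝ)} (hK : IsKorovkinSet K)
    (hKsub : ∀ g ∈ K, CInfty g) {μ : (ℝ → ℝ) → ℝ}
    (hadd : ∀ f g, CInfty f → CInfty g → μ (f + g) = μ f + μ g)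
    (hsmul : ∀ (c : ℝ) f, CInfty f → μ (c • f) = c * μ f)
    (hpos : ∀ f, CInfty f → (∀ x ≥ (0 : ℝ), 0 ≤ f x) → 0 ≤ μ f)
    (hbdd : ∃ C : ℝ, ∀ f, CInfty f → |μ f| ≤ C * supnorm f)
    {a c : ℝ} (ha : 0 ≤ a) (hc : 0 ≤ c) (hμ : ∀ g ∈ K, μ g = c * g a)
    {f : ℝ → ℝ} (hf : CInfty f) : μ f = c * f a := by
  obtain ⟨C, hC⟩ := hbdd
  have hc1 : 0 < c + 1 := by linarith
  have key := hK.functional_eq_eval hKsub (μ := fun f => (μ f + f a) / (c + 1))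
    ?_ ?_ ?_ ⟨(C + 1) / (c + 1), ?_⟩ ha ?_ hf
  · rw [div_eq_iff hc1.ne'] at key
    linarith
  · intro f g hf hg
    simp only [hadd f g hf hg, Pi.add_apply]; ring
  · intro c f hf
    simp only [hsmul c f hf, Pi.smul_apply, smul_eq_mul]; ring
  · intro f hf h
    exact div_nonneg (add_nonneg (hpos f hf h) (h a ha)) hc1.le
  · intro f hf
    rw [abs_div, abs_of_pos hc1, div_mul_eq_mul_div]
    gcongr
    linarith [abs_add_le (μ f) (f a), hC f hf, hf.abs_le_supnorm ha]
  · intro g hg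
    rw [hμ g hg, div_eq_iff hc1.ne']; ring

theorem Ultrafilter.tendsto_limUnder_of_abs_le {ι : Type*} (U : Ultrafilter ι) {u : ι → ℝ}
    {B : ℝ} (h : ∀ k, |u k| ≤ B) : Tendsto u U (nhds (limUnder U u)) := by
  obtain ⟨l, -, hl⟩ := (isCompact_Icc (a := -B) (b := B)).ultrafilter_le_nhds' (U.map u)
    (mem_map.2 (univ_mem' fun k => abs_le.1 (h k)))
  exact tendsto_nhds_limUnder ⟨l, hl⟩

/-- Along an ultrafilter, the weighted evaluations at a family of points of `[0,∞)` converge to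
a nonnegative multiple of a point evaluation. -/
theorem exists_tendsto_weighted_eval {ι : Type*} (U : Ultrafilter ι) {w : ℝ → ℝ}
    (hwc : ContinuousOn w (Set.Ici 0)) (hwpos : ∀ x ≥ (0 : ℝ), 0 < w x)
    {x : ι → ℝ} (hx : ∀ k, 0 ≤ x k) :
    ∃ a c : ℝ, 0 ≤ a ∧ 0 ≤ c ∧ ∀ f, CInftyW w f →
      Tendsto (fun k => w (x k) * f (x k)) U (nhds (c * f a)) := by
  by_cases hb : ∃ R, ∀ᶠ k in (U : Filter ι), x k ≤ R
  · obtain ⟨R, hR⟩ := hb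
    obtain ⟨a, ha, hl⟩ := (isCompact_Icc (a := (0 : ℝ)) (b := R)).ultrafilter_le_nhds' (U.map x)
      (mem_map.2 (hR.mono fun k hk => ⟨hx k, hk⟩))
    have hl' : Tendsto x U (nhdsWithin a (Set.Ici 0)) :=
      tendsto_nhdsWithin_iff.2 ⟨hl, Eventually.of_forall hx⟩
    exact ⟨a, w a, ha.1, (hwpos a ha.1).le, fun f hf =>
      ((hwc a ha.1).tendsto.mul (hf.1 a ha.1).tendsto).comp hl'⟩
  · push Not at hb
    refine ⟨0, 0, le_rfl, le_rfl, fun f hf => ?_⟩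
    rw [zero_mul]
    refine hf.2.comp (tendsto_atTop.2 fun R => ?_)
    exact (hb R).mono fun k hk => hk.le

/-- **Transfer of Korovkin sets to weighted spaces.**  Let `w` be a bounded, continuous and
strictly positive weight on `[0,∞)`.  Then every Korovkin set `K ⊆ C_∞([0,∞))` of
`C_∞([0,∞))` is also a Korovkin set of `C_∞^w([0,∞))`. -/
theorem korovkin_set_weighted_transfer (w : ℝ → ℝ)
    (hwc : ContinuousOn w (Set.Ici 0))
    (hwb : ∃ C : ℝ, ∀ x ≥ (0 : ℝ), w x ≤ C)
    (hwpos : ∀ x ≥ (0 : ℝ), 0 < w x)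
    (K : Set (ℝ → ℝ)) (hKsub : ∀ g ∈ K, CInfty g)
    (hK : IsKorovkinSet K) :
    IsKorovkinSetW w K := by
  intro L hmem hadd hsmul hpos hbdd hconv
  obtain ⟨C, hC⟩ := hbdd
  have ⟨B, hB⟩ := hwb
  have toW {f : ℝ → ℝ} (hf : CInfty f) : CInftyW w f := hf.cinftyW hwb hwpos
  have hdense : ∀ f, CInfty f → ∀ ε > (0 : ℝ), ∃ N : ℕ, ∀ n ≥ N, ∀ x ≥ (0 : ℝ),
      w x * |L n f x - f x| < ε := by
    intro f hf ε hε
    by_contra! hcon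
    choose n hn x hx hlarge using hcon
    let U : Ultrafilter ℕ := hyperfilter ℕ
    have hU : (U : Filter ℕ) ≤ atTop := Nat.hyperfilter_le_atTop
    obtain ⟨a, c, ha, hc, hev⟩ := exists_tendsto_weighted_eval U hwc hwpos hx
    let u : (ℝ → ℝ) → ℕ → ℝ := fun f k => w (x k) * L (n k) f (x k)
    have hlim {f : ℝ → ℝ} (hf : CInfty f) : Tendsto (u f) U (nhds (limUnder U (u f))) :=
      U.tendsto_limUnder_of_abs_le fun k => hC (n k) f (toW hf) (x k) (hx k)
    have hμ := hK.functional_eq_mul_eval hKsub (μ := fun f => limUnder U (u f))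
      ?_ ?_ ?_ ⟨|C| * B, ?_⟩ ha hc ?_ hf
    · have h0 : Tendsto (fun k => u f k - w (x k) * f (x k)) U (nhds 0) := by
        simpa [hμ] using (hlim hf).sub (hev f (toW hf))
      obtain ⟨k, hk⟩ := (h0.abs.eventually_lt_const (by simpa using hε)).exists
      refine absurd (hlarge k) (not_le.2 ?_)
      rwa [← mul_sub, abs_mul, abs_of_pos (hwpos _ (hx k))] at hk
    · intro f g hf hg
      refine tendsto_nhds_unique (hlim (hf.add hg)) (((hlim hf).add (hlim hg)).congr fun k => ?_)
      simp only [u, hadd _ f g (toW hf) (toW hg) _ (hx k)]; ring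
    · intro c f hf
      have hcf : CInfty (c • f) := ⟨hf.1.const_smul c, (smul_zero c : c • (0 : ℝ) = 0) ▸ hf.2.const_smul c⟩
      refine tendsto_nhds_unique (hlim hcf) (((hlim hf).const_mul c).congr fun k => ?_)
      simp only [u, hsmul _ c f (toW hf) _ (hx k)]; ring
    · intro f hf h
      exact ge_of_tendsto' (hlim hf) fun k =>
        mul_nonneg (hwpos _ (hx k)).le (hpos _ f (toW hf) h _ (hx k))
    · intro f hf
      refine le_of_tendsto' (hlim hf).abs fun k => (hC (n k) f (toW hf) (x k) (hx k)).trans ?_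
      have hbound : ∀ y ≥ (0 : ℝ), |w y * f y| ≤ B * supnorm f := fun y hy => by
        rw [abs_mul, abs_of_pos (hwpos y hy)]
        exact mul_le_mul (hB y hy) (hf.abs_le_supnorm hy) (abs_nonneg _)
          ((hwpos y hy).le.trans (hB y hy))
      have h0 : 0 ≤ wsupnorm w f := Real.iSup_nonneg fun _ => abs_nonneg _
      rw [mul_assoc]
      exact mul_le_mul (le_abs_self C) (wsupnorm_le hbound) h0 (abs_nonneg C)
    · intro g hg
      have hg' := hKsub g hg
      have h0 : Tendsto (fun k => u g k - w (x k) * g (x k)) atTop (nhds 0) := by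
        refine Metric.tendsto_atTop.2 fun ε hε => ?_
        obtain ⟨N, hN⟩ := hconv g hg ε hε
        refine ⟨N, fun k hk => ?_⟩
        rw [Real.dist_eq, sub_zero, ← mul_sub, abs_mul, abs_of_pos (hwpos _ (hx k))]
        exact hN (n k) (hk.trans (hn k)) (x k) (hx k)
      refine tendsto_nhds_unique (hlim hg') ?_
      simpa using (h0.mono_left hU).add (hev g (toW hg'))
  intro f hf ε hε
  have hC1 : 0 < |C| + 1 := by positivity
  obtain ⟨h, hh, hfh⟩ := hf.exists_cinfty_approx (ε := ε / 2 / (|C| + 1)) (by positivity)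
  obtain ⟨N, hN⟩ := hdense h hh (ε / 2) (by positivity)
  refine ⟨N, fun n hn x hx => ?_⟩
  have hd : CInftyW w (f - h) := hf.sub (toW hh)
  have hLd : |w x * L n (f - h) x| ≤ |C| * (ε / 2 / (|C| + 1)) :=
    (hC n _ hd x hx).trans (mul_le_mul (le_abs_self C) (wsupnorm_le hfh)
      (Real.iSup_nonneg fun _ => abs_nonneg _) (abs_nonneg C))
  have hL : L n f x = L n h x + L n (f - h) x := by
    rw [← hadd n h (f - h) (toW hh) hd x hx, add_sub_cancel]
  have hsplit : w x * (L n f x - f x)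
      = w x * (L n h x - h x) + (w x * L n (f - h) x - w x * (f - h) x) := by
    rw [hL, Pi.sub_apply]; ring
  have hNx := hN n hn x hx
  rw [← abs_of_pos (hwpos x hx), ← abs_mul] at hNx ⊢
  have hsum : |C| * (ε / 2 / (|C| + 1)) + ε / 2 / (|C| + 1) = ε / 2 := by
    field_simp
  rw [hsplit]
  linarith [abs_add_le (w x * (L n h x - h x)) (w x * L n (f - h) x - w x * (f - h) x),
    abs_sub (w x * L n (f - h) x) (w x * (f - h) x), hfh x hx]
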